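/- Every atomic flow is the atomic flow associated with some SKS derivation. -/

import Mathlib

set_option linter.unusedVariables false

namespace AF

/-! ### Formulae of system SKS.

Atoms are pairs `(n, b)`; the involution `ā` flips the Boolean, so it is
fixed-point free. -/

inductive Formula : Type
  | tt : Formula
  | ff : Formula
  | atom : ℕ → Bool → Formula
  | or : Formula → Formula → Formula
  | and : Formula → Formula → Formula
  deriving DecidableEq

namespace Formula

/-- Subformula at a position (`false` = left child, `true` = right child). -/
def sub : Formula → List Bool → Option Formula
  | φ, [] => some φ
  | .or α _, false :: p => sub α p
  | .or _ β, true :: p => sub β p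
  | .and α _, false :: p => sub α p
  | .and _ β, true :: p => sub β p
  | _, _ :: _ => none

/-- Replace the subformula at a position. -/
def repl : Formula → List Bool → Formula → Formula
  | _, [], ψ => ψ
  | .or α β, false :: p, ψ => .or (repl α p ψ) β
  | .or α β, true :: p, ψ => .or α (repl β p ψ)
  | .and α β, false :: p, ψ => .and (repl α p ψ) β
  | .and α β, true :: p, ψ => .and α (repl β p ψ)
  | φ, _ :: _, _ => φ

/-- `p` is an atom occurrence of `φ`. -/
def IsOcc (φ : Formula) (p : List Bool) : Prop :=
  ∃ n b, φ.sub p = some (.atom n b)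

end Formula

/-! ### Inference rules.

The rule `=` of SKS replaces a formula by an equivalent one under
commutativity, associativity and the unit equations; each single instance of
`=` applies one equation (in either direction), so we list the equations as
individual rule names, all marked as being instances of `=` via `isEq`. -/

inductive RuleName : Type
  | aiDown | aiUp | awDown | awUp | acDown | acUp
  | s | m
  | eqOrComm | eqAndComm
  | eqOrAssocL | eqOrAssocR | eqAndAssocL | eqAndAssocR
  | eqOrUnitDel | eqOrUnitAdd | eqAndUnitDel | eqAndUnitAdd
  | eqTTDel | eqTTAdd | eqFFDel | eqFFAdd
  deriving DecidableEq

namespace RuleName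

/-- The atomic structural rules. -/
def isStructural : RuleName → Bool
  | .aiDown | .aiUp | .awDown | .awUp | .acDown | .acUp => true
  | _ => false

/-- The rule names that are instances of the rule `=`. -/
def isEq : RuleName → Bool
  | .aiDown | .aiUp | .awDown | .awUp | .acDown | .acUp | .s | .m => false
  | _ => true

end RuleName

/-- Rule instances (redex ⟹ contractum). -/
inductive RuleInstance : RuleName → Formula → Formula → Prop
  | aiDown (n : ℕ) (b : Bool) :
      RuleInstance .aiDown .tt (.or (.atom n b) (.atom n (!b)))
  | aiUp (n : ℕ) (b : Bool) :
      RuleInstance .aiUp (.and (.atom n b) (.atom n (!b))) .ff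
  | awDown (n : ℕ) (b : Bool) : RuleInstance .awDown .ff (.atom n b)
  | awUp (n : ℕ) (b : Bool) : RuleInstance .awUp (.atom n b) .tt
  | acDown (n : ℕ) (b : Bool) :
      RuleInstance .acDown (.or (.atom n b) (.atom n b)) (.atom n b)
  | acUp (n : ℕ) (b : Bool) :
      RuleInstance .acUp (.atom n b) (.and (.atom n b) (.atom n b))
  | s (α β γ : Formula) :
      RuleInstance .s (.and α (.or β γ)) (.or (.and α β) γ)
  | m (α β γ δ : Formula) :
      RuleInstance .m (.or (.and α β) (.and γ δ)) (.and (.or α γ) (.or β δ))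
  | eqOrComm (α β : Formula) : RuleInstance .eqOrComm (.or α β) (.or β α)
  | eqAndComm (α β : Formula) : RuleInstance .eqAndComm (.and α β) (.and β α)
  | eqOrAssocL (α β γ : Formula) :
      RuleInstance .eqOrAssocL (.or (.or α β) γ) (.or α (.or β γ))
  | eqOrAssocR (α β γ : Formula) :
      RuleInstance .eqOrAssocR (.or α (.or β γ)) (.or (.or α β) γ)
  | eqAndAssocL (α β γ : Formula) :
      RuleInstance .eqAndAssocL (.and (.and α β) γ) (.and α (.and β γ))
  | eqAndAssocR (α β γ : Formula) :
      RuleInstance .eqAndAssocR (.and α (.and β γ)) (.and (.and α β) γ)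
  | eqOrUnitDel (α : Formula) : RuleInstance .eqOrUnitDel (.or α .ff) α
  | eqOrUnitAdd (α : Formula) : RuleInstance .eqOrUnitAdd α (.or α .ff)
  | eqAndUnitDel (α : Formula) : RuleInstance .eqAndUnitDel (.and α .tt) α
  | eqAndUnitAdd (α : Formula) : RuleInstance .eqAndUnitAdd α (.and α .tt)
  | eqTTDel : RuleInstance .eqTTDel (.or .tt .tt) .tt
  | eqTTAdd : RuleInstance .eqTTAdd .tt (.or .tt .tt)
  | eqFFDel : RuleInstance .eqFFDel (.and .ff .ff) .ff
  | eqFFAdd : RuleInstance .eqFFAdd .ff (.and .ff .ff)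

/-- One (deep) inference step applying rule `r` at position `q`. -/
def StepAt (r : RuleName) (q : List Bool) (φ ψ : Formula) : Prop :=
  ∃ γ δ, φ.sub q = some γ ∧ RuleInstance r γ δ ∧ ψ = φ.repl q δ

/-- One inference step using a rule from the set `S`. -/
def Step (S : Set RuleName) (φ ψ : Formula) : Prop :=
  ∃ r ∈ S, ∃ q, StepAt r q φ ψ

/-- There is a derivation from `φ` to `ψ` using only rules from `S`. -/
def Derives (S : Set RuleName) : Formula → Formula → Prop :=
  Relation.ReflTransGen (Step S)

/-! ### Derivations as explicit data (for the theory of atomic flows). -/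

/-- A derivation: a premiss and a chain of steps, each recorded by its rule
name, the position of the redex, and the resulting formula. -/
structure Deriv : Type where
  prem : Formula
  steps : List (RuleName × List Bool × Formula)

namespace Deriv

/-- The `i`-th step datum. -/
def stepAt (Φ : Deriv) (i : ℕ) : RuleName × List Bool × Formula :=
  Φ.steps.getD i (RuleName.s, ([] : List Bool), Formula.tt)

/-- The `i`-th formula of the derivation (`0` is the premiss). -/
def fml (Φ : Deriv) (i : ℕ) : Formula :=
  (Φ.prem :: Φ.steps.map (fun t => t.2.2)).getD i Φ.prem

/-- Number of formulae in the derivation. -/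
def nf (Φ : Deriv) : ℕ := Φ.steps.length + 1

/-- The conclusion of the derivation. -/
def concl (Φ : Deriv) : Formula := Φ.fml Φ.steps.length

/-- The derivation is well formed: every recorded step is a correct
inference step of SKS. -/
def WF (Φ : Deriv) : Prop :=
  ∀ i, i < Φ.steps.length →
    StepAt (Φ.stepAt i).1 (Φ.stepAt i).2.1 (Φ.fml i) (Φ.fml (i + 1))

end Deriv

/-! ### Atomic flows. -/

inductive FlowLabel : Type
  | aiDown | aiUp | awDown | awUp | acDown | acUp
  deriving DecidableEq

/-- Required (number of lower edges, number of upper edges) of a vertex. -/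
def labDeg : FlowLabel → ℕ × ℕ
  | .aiDown => (2, 0)
  | .aiUp => (0, 2)
  | .awDown => (1, 0)
  | .awUp => (0, 1)
  | .acDown => (1, 2)
  | .acUp => (2, 1)

/-- The data of an atomic flow: vertices, edges, labels, and the two
endpoint maps.  `up e = none` means the upper endpoint is `⊤`, and
`lo e = none` means the lower endpoint is `⊥`. -/
structure PreFlow : Type where
  V : Finset ℕ
  E : Finset ℕ
  η : ℕ → FlowLabel
  up : ℕ → Option ℕ
  lo : ℕ → Option ℕ

namespace PreFlow

/-- Lower edges of a vertex. -/
def Ledges (F : PreFlow) (v : ℕ) : Finset ℕ :=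
  F.E.filter (fun e => F.up e = some v)

/-- Upper edges of a vertex. -/
def Uedges (F : PreFlow) (v : ℕ) : Finset ℕ :=
  F.E.filter (fun e => F.lo e = some v)

/-- All edges of a vertex. -/
def edges (F : PreFlow) (v : ℕ) : Finset ℕ := F.Ledges v ∪ F.Uedges v

def degOK (F : PreFlow) : Prop :=
  ∀ v ∈ F.V, (F.Ledges v).card = (labDeg (F.η v)).1 ∧
    (F.Uedges v).card = (labDeg (F.η v)).2

def endpointsOK (F : PreFlow) : Prop :=
  ∀ e ∈ F.E, (∀ v, F.up e = some v → v ∈ F.V) ∧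
    (∀ v, F.lo e = some v → v ∈ F.V)

/-- No cyclic sequence of edges `ε₁, …, ε_h` with
`up (ε_i) = lo (ε_(i+1 mod h))`. -/
def Acyclic (F : PreFlow) : Prop :=
  ¬ ∃ (h : ℕ) (ε : Fin (h + 1) → ℕ), (∀ i, ε i ∈ F.E) ∧
      ∀ i : Fin (h + 1), (F.up (ε i)).isSome ∧ F.up (ε i) = F.lo (ε (i + 1))

/-- `π` is a polarity assignment (`false` = `−`, `true` = `+`). -/
def PolarityOK (F : PreFlow) (π : ℕ → Bool) : Prop :=
  ∀ v ∈ F.V,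
    ((F.η v = .acDown ∨ F.η v = .acUp) →
      ∀ e₁ ∈ F.edges v, ∀ e₂ ∈ F.edges v, π e₁ = π e₂) ∧
    ((F.η v = .aiDown ∨ F.η v = .aiUp) →
      ∃ e₁ ∈ F.edges v, ∃ e₂ ∈ F.edges v, π e₁ ≠ π e₂)

/-- `F` is an atomic flow. -/
def IsFlow (F : PreFlow) : Prop :=
  F.degOK ∧ F.endpointsOK ∧ F.Acyclic ∧ ∃ π, F.PolarityOK π

end PreFlow

/-! ### Paths, ai-paths, cycles. -/

/-- An endpoint of a path: a vertex, or `⊤`, or `⊥`. -/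
inductive VPt : Type
  | ver : ℕ → VPt
  | top : VPt
  | bot : VPt
  deriving DecidableEq

/-- The upper endpoint of edge `e` is `ν`. -/
def srcOK (F : PreFlow) (ν : VPt) (e : ℕ) : Prop :=
  match ν with
  | .ver v => F.up e = some v
  | .top => F.up e = none
  | .bot => False

/-- The lower endpoint of edge `e` is `ν`. -/
def tgtOK (F : PreFlow) (ν : VPt) (e : ℕ) : Prop :=
  match ν with
  | .ver v => F.lo e = some v
  | .bot => F.lo e = none
  | .top => False

/-- A downward path from `ν` to `ν'` (a nonempty sequence of edges, each
hanging from the lower endpoint of the previous one). -/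
def IsDownPath (F : PreFlow) (ν ν' : VPt) (l : List ℕ) : Prop :=
  l ≠ [] ∧ (∀ e ∈ l, e ∈ F.E) ∧
  (∀ i, i + 1 < l.length →
    ∃ v ∈ F.V, F.lo (l.getD i 0) = some v ∧ F.up (l.getD (i + 1) 0) = some v) ∧
  srcOK F ν (l.getD 0 0) ∧ tgtOK F ν' (l.getD (l.length - 1) 0)

/-- A path from `ν` to `ν'`: a downward path, or the reverse of a
downward path from `ν'` to `ν`. -/
def IsPath (F : PreFlow) (ν ν' : VPt) (l : List ℕ) : Prop :=
  IsDownPath F ν ν' l ∨ IsDownPath F ν' ν l.reverse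

/-- ai-paths: paths, closed under concatenation (in distinct edges) at
interaction and cointeraction vertices. -/
inductive AIPath (F : PreFlow) : VPt → VPt → List ℕ → Prop
  | single {ν ν' : VPt} {l : List ℕ} : IsPath F ν ν' l → AIPath F ν ν' l
  | join {ν ν' : VPt} {v : ℕ} {l₁ l₂ : List ℕ} {e e' : ℕ} :
      v ∈ F.V → (F.η v = .aiDown ∨ F.η v = .aiUp) →
      AIPath F ν (.ver v) (l₁ ++ [e]) →
      AIPath F (.ver v) ν' (e' :: l₂) →
      e ≠ e' →
      AIPath F ν ν' (l₁ ++ [e] ++ e' :: l₂)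

/-- The flow contains an ai-cycle: an ai-path from a vertex to itself in
which no edge appears twice. -/
def HasAICycle (F : PreFlow) : Prop :=
  ∃ v l, v ∈ F.V ∧ AIPath F (.ver v) (.ver v) l ∧ l.Nodup

def CycleFree (F : PreFlow) : Prop := ¬ HasAICycle F

/-- An ai-connection: a path from an interaction vertex to a cointeraction
vertex or vice versa. -/
def IsConnection (F : PreFlow) (l : List ℕ) : Prop :=
  ∃ v v', v ∈ F.V ∧ v' ∈ F.V ∧
    ((F.η v = .aiDown ∧ F.η v' = .aiUp) ∨
     (F.η v = .aiUp ∧ F.η v' = .aiDown)) ∧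
    IsPath F (.ver v) (.ver v') l

/-- A simple edge: an ai-connection consisting of a single edge. -/
def SimpleEdge (F : PreFlow) (e : ℕ) : Prop := IsConnection F [e]

/-- A clean path: an ai-path all of whose ai-connections are simple edges. -/
def IsCleanPath (F : PreFlow) (ν ν' : VPt) (l : List ℕ) : Prop :=
  AIPath F ν ν' l ∧
  ∀ l₁ l₂ l₃, l = l₁ ++ l₂ ++ l₃ → IsConnection F l₂ → l₂.length = 1

/-! ### Local flow reduction rules. -/

open PreFlow

/-- Rule `w↓-c↓`: a weakening feeding a contraction is erased, merging the
contraction's other two edges. -/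
def RedWdCd (A B : PreFlow) : Prop :=
  ∃ v₁ v₂ e e₂ e₃,
    v₁ ∈ A.V ∧ v₂ ∈ A.V ∧ v₁ ≠ v₂ ∧
    A.η v₁ = .awDown ∧ A.η v₂ = .acDown ∧
    e ∈ A.E ∧ e₂ ∈ A.E ∧ e₃ ∈ A.E ∧ e ≠ e₂ ∧ e ≠ e₃ ∧ e₂ ≠ e₃ ∧
    A.up e = some v₁ ∧ A.lo e = some v₂ ∧
    A.lo e₂ = some v₂ ∧ A.up e₃ = some v₂ ∧
    B.V = (A.V.erase v₁).erase v₂ ∧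
    B.E = (A.E.erase e).erase e₃ ∧
    B.η = A.η ∧ B.up = A.up ∧
    B.lo = Function.update A.lo e₂ (A.lo e₃)

/-- Rule `c↑-w↑` (dual of `w↓-c↓`). -/
def RedCuWu (A B : PreFlow) : Prop :=
  ∃ v₁ v₂ e e₂ e₃,
    v₁ ∈ A.V ∧ v₂ ∈ A.V ∧ v₁ ≠ v₂ ∧
    A.η v₁ = .awUp ∧ A.η v₂ = .acUp ∧
    e ∈ A.E ∧ e₂ ∈ A.E ∧ e₃ ∈ A.E ∧ e ≠ e₂ ∧ e ≠ e₃ ∧ e₂ ≠ e₃ ∧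
    A.lo e = some v₁ ∧ A.up e = some v₂ ∧
    A.up e₂ = some v₂ ∧ A.lo e₃ = some v₂ ∧
    B.V = (A.V.erase v₁).erase v₂ ∧
    B.E = (A.E.erase e).erase e₃ ∧
    B.η = A.η ∧ B.lo = A.lo ∧
    B.up = Function.update A.up e₂ (A.up e₃)

/-- Rule `w↓-i↑`: a weakening feeding a cointeraction is replaced by a
coweakening on the other cointeraction edge. -/
def RedWdIu (A B : PreFlow) : Prop :=
  ∃ v₁ v₂ e e₂,
    v₁ ∈ A.V ∧ v₂ ∈ A.V ∧ v₁ ≠ v₂ ∧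
    A.η v₁ = .awDown ∧ A.η v₂ = .aiUp ∧
    e ∈ A.E ∧ e₂ ∈ A.E ∧ e ≠ e₂ ∧
    A.up e = some v₁ ∧ A.lo e = some v₂ ∧ A.lo e₂ = some v₂ ∧
    B.V = A.V.erase v₁ ∧ B.E = A.E.erase e ∧
    B.η = Function.update A.η v₂ .awUp ∧
    B.up = A.up ∧ B.lo = A.lo

/-- Rule `i↓-w↑` (dual of `w↓-i↑`). -/
def RedIdWu (A B : PreFlow) : Prop :=
  ∃ v₁ v₂ e e₂,
    v₁ ∈ A.V ∧ v₂ ∈ A.V ∧ v₁ ≠ v₂ ∧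
    A.η v₁ = .awUp ∧ A.η v₂ = .aiDown ∧
    e ∈ A.E ∧ e₂ ∈ A.E ∧ e ≠ e₂ ∧
    A.lo e = some v₁ ∧ A.up e = some v₂ ∧ A.up e₂ = some v₂ ∧
    B.V = A.V.erase v₁ ∧ B.E = A.E.erase e ∧
    B.η = Function.update A.η v₂ .awDown ∧
    B.up = A.up ∧ B.lo = A.lo

/-- Rule `w↓-w↑`: a weakening joined to a coweakening is erased. -/
def RedWdWu (A B : PreFlow) : Prop :=
  ∃ v₁ v₂ e,
    v₁ ∈ A.V ∧ v₂ ∈ A.V ∧ v₁ ≠ v₂ ∧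
    A.η v₁ = .awDown ∧ A.η v₂ = .awUp ∧
    e ∈ A.E ∧ A.up e = some v₁ ∧ A.lo e = some v₂ ∧
    B.V = (A.V.erase v₁).erase v₂ ∧ B.E = A.E.erase e ∧
    B.η = A.η ∧ B.up = A.up ∧ B.lo = A.lo

/-- Rule `w↓-c↑`: a weakening feeding a cocontraction is replaced by two
weakenings. -/
def RedWdCu (A B : PreFlow) : Prop :=
  ∃ v₁ v₂ e e₁ e₂,
    v₁ ∈ A.V ∧ v₂ ∈ A.V ∧ v₁ ≠ v₂ ∧
    A.η v₁ = .awDown ∧ A.η v₂ = .acUp ∧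
    e ∈ A.E ∧ e₁ ∈ A.E ∧ e₂ ∈ A.E ∧ e ≠ e₁ ∧ e ≠ e₂ ∧ e₁ ≠ e₂ ∧
    A.up e = some v₁ ∧ A.lo e = some v₂ ∧
    A.up e₁ = some v₂ ∧ A.up e₂ = some v₂ ∧
    B.V = A.V ∧ B.E = A.E.erase e ∧
    B.η = Function.update A.η v₂ .awDown ∧
    B.up = Function.update A.up e₁ (some v₁) ∧
    B.lo = A.lo

/-- Rule `c↓-w↑` (dual of `w↓-c↑`). -/
def RedCdWu (A B : PreFlow) : Prop :=
  ∃ v₁ v₂ e e₁ e₂,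
    v₁ ∈ A.V ∧ v₂ ∈ A.V ∧ v₁ ≠ v₂ ∧
    A.η v₁ = .awUp ∧ A.η v₂ = .acDown ∧
    e ∈ A.E ∧ e₁ ∈ A.E ∧ e₂ ∈ A.E ∧ e ≠ e₁ ∧ e ≠ e₂ ∧ e₁ ≠ e₂ ∧
    A.lo e = some v₁ ∧ A.up e = some v₂ ∧
    A.lo e₁ = some v₂ ∧ A.lo e₂ = some v₂ ∧
    B.V = A.V ∧ B.E = A.E.erase e ∧
    B.η = Function.update A.η v₂ .awUp ∧
    B.lo = Function.update A.lo e₁ (some v₁) ∧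
    B.up = A.up

/-- Rule `c↓-i↑`: a contraction whose output edge enters a cointeraction is
replaced by a cocontraction on the other cointeraction edge followed by two
cointeractions. -/
def RedCdIu (A B : PreFlow) : Prop :=
  ∃ v₁ v₂ v₃ e e₁ e₂ e₃ g₁ g₂,
    v₁ ∈ A.V ∧ v₂ ∈ A.V ∧ v₁ ≠ v₂ ∧ v₃ ∉ A.V ∧
    A.η v₁ = .acDown ∧ A.η v₂ = .aiUp ∧
    e ∈ A.E ∧ e₁ ∈ A.E ∧ e₂ ∈ A.E ∧ e₃ ∈ A.E ∧
    e ≠ e₁ ∧ e ≠ e₂ ∧ e ≠ e₃ ∧ e₁ ≠ e₂ ∧ e₁ ≠ e₃ ∧ e₂ ≠ e₃ ∧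
    g₁ ∉ A.E ∧ g₂ ∉ A.E ∧ g₁ ≠ g₂ ∧
    A.lo e₁ = some v₁ ∧ A.lo e₂ = some v₁ ∧
    A.up e = some v₁ ∧ A.lo e = some v₂ ∧ A.lo e₃ = some v₂ ∧
    B.V = insert v₃ A.V ∧
    B.E = insert g₁ (insert g₂ (A.E.erase e)) ∧
    B.η = Function.update (Function.update A.η v₁ .acUp) v₃ .aiUp ∧
    B.up = Function.update (Function.update A.up g₁ (some v₁)) g₂ (some v₁) ∧
    B.lo = Function.update (Function.update (Function.update
      (Function.update (Function.update A.lo e₁ (some v₂)) e₂ (some v₃))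
        e₃ (some v₁)) g₁ (some v₂)) g₂ (some v₃)

/-- Rule `i↓-c↑` (dual of `c↓-i↑`). -/
def RedIdCu (A B : PreFlow) : Prop :=
  ∃ v₁ v₂ v₃ e e₁ e₂ e₃ g₁ g₂,
    v₁ ∈ A.V ∧ v₂ ∈ A.V ∧ v₁ ≠ v₂ ∧ v₃ ∉ A.V ∧
    A.η v₁ = .acUp ∧ A.η v₂ = .aiDown ∧
    e ∈ A.E ∧ e₁ ∈ A.E ∧ e₂ ∈ A.E ∧ e₃ ∈ A.E ∧
    e ≠ e₁ ∧ e ≠ e₂ ∧ e ≠ e₃ ∧ e₁ ≠ e₂ ∧ e₁ ≠ e₃ ∧ e₂ ≠ e₃ ∧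
    g₁ ∉ A.E ∧ g₂ ∉ A.E ∧ g₁ ≠ g₂ ∧
    A.up e₁ = some v₁ ∧ A.up e₂ = some v₁ ∧
    A.lo e = some v₁ ∧ A.up e = some v₂ ∧ A.up e₃ = some v₂ ∧
    B.V = insert v₃ A.V ∧
    B.E = insert g₁ (insert g₂ (A.E.erase e)) ∧
    B.η = Function.update (Function.update A.η v₁ .acDown) v₃ .aiDown ∧
    B.lo = Function.update (Function.update A.lo g₁ (some v₁)) g₂ (some v₁) ∧
    B.up = Function.update (Function.update (Function.update
      (Function.update (Function.update A.up e₁ (some v₂)) e₂ (some v₃))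
        e₃ (some v₁)) g₁ (some v₂)) g₂ (some v₃)

/-- Rule `c↓-c↑`: a contraction whose output enters a cocontraction is
replaced by two cocontractions above two contractions, crosswise connected. -/
def RedCdCu (A B : PreFlow) : Prop :=
  ∃ v₁ v₂ v₃ v₄ e e₁ e₂ e₃ e₄ g₁₁ g₁₂ g₂₁ g₂₂,
    v₁ ∈ A.V ∧ v₂ ∈ A.V ∧ v₁ ≠ v₂ ∧
    v₃ ∉ A.V ∧ v₄ ∉ A.V ∧ v₃ ≠ v₄ ∧
    A.η v₁ = .acDown ∧ A.η v₂ = .acUp ∧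
    e ∈ A.E ∧ e₁ ∈ A.E ∧ e₂ ∈ A.E ∧ e₃ ∈ A.E ∧ e₄ ∈ A.E ∧
    e ≠ e₁ ∧ e ≠ e₂ ∧ e ≠ e₃ ∧ e ≠ e₄ ∧
    e₁ ≠ e₂ ∧ e₁ ≠ e₃ ∧ e₁ ≠ e₄ ∧ e₂ ≠ e₃ ∧ e₂ ≠ e₄ ∧ e₃ ≠ e₄ ∧
    g₁₁ ∉ A.E ∧ g₁₂ ∉ A.E ∧ g₂₁ ∉ A.E ∧ g₂₂ ∉ A.E ∧
    g₁₁ ≠ g₁₂ ∧ g₁₁ ≠ g₂₁ ∧ g₁₁ ≠ g₂₂ ∧ g₁₂ ≠ g₂₁ ∧ g₁₂ ≠ g₂₂ ∧ g₂₁ ≠ g₂₂ ∧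
    A.lo e₁ = some v₁ ∧ A.lo e₂ = some v₁ ∧ A.up e = some v₁ ∧
    A.lo e = some v₂ ∧ A.up e₃ = some v₂ ∧ A.up e₄ = some v₂ ∧
    B.V = insert v₃ (insert v₄ A.V) ∧
    B.E = insert g₁₁ (insert g₁₂ (insert g₂₁ (insert g₂₂ (A.E.erase e)))) ∧
    B.η = Function.update (Function.update (Function.update
      (Function.update A.η v₁ .acUp) v₂ .acUp) v₃ .acDown) v₄ .acDown ∧
    B.up = Function.update (Function.update (Function.update
      (Function.update (Function.update (Function.update A.up
        e₃ (some v₃)) e₄ (some v₄)) g₁₁ (some v₁)) g₁₂ (some v₁))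
          g₂₁ (some v₂)) g₂₂ (some v₂) ∧
    B.lo = Function.update (Function.update (Function.update
      (Function.update (Function.update A.lo e₂ (some v₂)) g₁₁ (some v₃))
        g₁₂ (some v₄)) g₂₁ (some v₃)) g₂₂ (some v₄)

/-- One step of the flow rewriting system `w`. -/
def StepW (A B : PreFlow) : Prop :=
  RedWdCd A B ∨ RedCuWu A B ∨ RedWdIu A B ∨ RedIdWu A B ∨
  RedWdWu A B ∨ RedWdCu A B ∨ RedCdWu A B

/-- One step of the flow rewriting system `c`. -/
def StepC (A B : PreFlow) : Prop :=
  RedCdIu A B ∨ RedIdCu A B ∨ RedCdCu A B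

/-- `A` is normal for the flow rewriting system `w`. -/
def NormalW (A : PreFlow) : Prop := ¬ ∃ B, StepW A B

/-- `A` is normal for the flow rewriting system `c`. -/
def NormalC (A : PreFlow) : Prop := ¬ ∃ B, StepC A B

/-! ### Flow isomorphisms. -/

structure FlowIso (A B : PreFlow) : Type where
  vmap : ℕ → ℕ
  emap : ℕ → ℕ
  vbij : Set.BijOn vmap (A.V : Set ℕ) (B.V : Set ℕ)
  ebij : Set.BijOn emap (A.E : Set ℕ) (B.E : Set ℕ)
  lab : ∀ v ∈ A.V, B.η (vmap v) = A.η v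
  upc : ∀ e ∈ A.E, B.up (emap e) = (A.up e).map vmap
  loc : ∀ e ∈ A.E, B.lo (emap e) = (A.lo e).map vmap

/-! ### The global reduction `→se` (elimination of a simple edge). -/

/-- The flow obtained from `B` by eliminating the simple edge `e0` between
the interaction `vi` and the cointeraction `vc` (with `e2` the other lower
edge of `vi` and `e3` the other upper edge of `vc`): two copies (tags `0`,
hat, the lower one, and `1`, tilde, the upper one) of the remaining flow are
glued by identifying the hat copy of `e2` with the tilde copy of `e3`; a
weakening (vertex `(2,0)`) is placed above the tilde copy of `e2`, a
coweakening (vertex `(2,1)`) below the hat copy of `e3`; each upper edge `ε`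
of `B` gives a cocontraction (vertex `(3,ε)`, with a new upper edge `(3,ε)`)
joining the two copies of `ε`, and dually each lower edge `ε'` of `B` gives
a contraction (vertex `(4,ε')`, with a new lower edge `(4,ε')`). -/
def seFlow (B : PreFlow) (vi vc e0 e2 e3 : ℕ) : PreFlow :=
  { V := ((B.V.erase vi).erase vc).image (Nat.pair 0) ∪
         ((B.V.erase vi).erase vc).image (Nat.pair 1) ∪
         {Nat.pair 2 0, Nat.pair 2 1} ∪
         (B.E.filter (fun e => B.up e = none)).image (Nat.pair 3) ∪
         (B.E.filter (fun e => B.lo e = none)).image (Nat.pair 4),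
    E := (B.E.erase e0).image (Nat.pair 0) ∪
         (B.E.erase e0).image (fun e => if e = e3 then Nat.pair 0 e2 else Nat.pair 1 e) ∪
         (B.E.filter (fun e => B.up e = none)).image (Nat.pair 3) ∪
         (B.E.filter (fun e => B.lo e = none)).image (Nat.pair 4),
    η := fun x =>
      if (Nat.unpair x).1 = 2 then
        (if (Nat.unpair x).2 = 0 then FlowLabel.awDown else FlowLabel.awUp)
      else if (Nat.unpair x).1 = 3 then FlowLabel.acUp
      else if (Nat.unpair x).1 = 4 then FlowLabel.acDown
      else B.η (Nat.unpair x).2,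
    up := fun x =>
      let t := (Nat.unpair x).1
      let y := (Nat.unpair x).2
      if t = 0 then
        (if y = e2 then
          (match B.up e3 with
           | some v => some (Nat.pair 1 v)
           | none => some (Nat.pair 3 e3))
        else
          (match B.up y with
           | some v => some (Nat.pair 0 v)
           | none => some (Nat.pair 3 y)))
      else if t = 1 then
        (if y = e2 then some (Nat.pair 2 0)
        else
          (match B.up y with
           | some v => some (Nat.pair 1 v)
           | none => some (Nat.pair 3 y)))
      else if t = 3 then none
      else some (Nat.pair 4 y),
    lo := fun x =>
      let t := (Nat.unpair x).1
      let y := (Nat.unpair x).2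
      if t = 0 then
        (if y = e2 then
          (match B.lo e2 with
           | some v => some (Nat.pair 0 v)
           | none => some (Nat.pair 4 e2))
        else if y = e3 then some (Nat.pair 2 1)
        else
          (match B.lo y with
           | some v => some (Nat.pair 0 v)
           | none => some (Nat.pair 4 y)))
      else if t = 1 then
        (match B.lo y with
         | some v => some (Nat.pair 1 v)
         | none => some (Nat.pair 4 y))
      else if t = 3 then some (Nat.pair 3 y)
      else none }

/-- The reduction `→se`: elimination of a simple edge (up to flow
isomorphism). -/
def RedSE (B C : PreFlow) : Prop :=
  ∃ vi vc e0 e2 e3,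
    vi ∈ B.V ∧ vc ∈ B.V ∧ vi ≠ vc ∧
    B.η vi = .aiDown ∧ B.η vc = .aiUp ∧
    e0 ∈ B.E ∧ e2 ∈ B.E ∧ e3 ∈ B.E ∧
    e0 ≠ e2 ∧ e0 ≠ e3 ∧ e2 ≠ e3 ∧
    B.up e0 = some vi ∧ B.lo e0 = some vc ∧
    B.up e2 = some vi ∧ B.lo e3 = some vc ∧
    Nonempty (FlowIso C (seFlow B vi vc e0 e2 e3))

/-! ### The atomic flow associated with a derivation. -/

/-- Correspondence conditions for a linear rule applied at position `q`:
for each pair `(c₁, c₂)` in `cs`, occurrences at `q ++ c₁ ++ p` in the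
conclusion (formula `i+1`) are traced to occurrences at `q ++ c₂ ++ p` in
the premiss (formula `i`). -/
def corrCond (f : ℕ → List Bool → ℕ) (i : ℕ) (q : List Bool) (ψ : Formula)
    (cs : List (List Bool × List Bool)) : Prop :=
  ∀ c ∈ cs, ∀ p : List Bool, ψ.IsOcc (q ++ c.1 ++ p) →
    f (i + 1) (q ++ c.1 ++ p) = f i (q ++ c.2 ++ p)

/-- The tracing conditions for one inference step: occurrences in the
context are traced to the same edge, and the active occurrences of a
structural rule are related to the edges of the vertex `v` as prescribed by
its label, while the active occurrences of logical and `=` steps are traced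
to the same edges under the canonical correspondence. -/
def stepCond (A : PreFlow) (f : ℕ → List Bool → ℕ) (v : ℕ) (i : ℕ)
    (r : RuleName) (q : List Bool) (φ ψ : Formula) : Prop :=
  (∀ p, ¬ (q <+: p) → φ.IsOcc p → f (i + 1) p = f i p) ∧
  match r with
  | .aiDown =>
      A.η v = .aiDown ∧
      A.up (f (i + 1) (q ++ [false])) = some v ∧
      A.up (f (i + 1) (q ++ [true])) = some v ∧
      f (i + 1) (q ++ [false]) ≠ f (i + 1) (q ++ [true])
  | .aiUp =>
      A.η v = .aiUp ∧
      A.lo (f i (q ++ [false])) = some v ∧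
      A.lo (f i (q ++ [true])) = some v ∧
      f i (q ++ [false]) ≠ f i (q ++ [true])
  | .awDown => A.η v = .awDown ∧ A.up (f (i + 1) q) = some v
  | .awUp => A.η v = .awUp ∧ A.lo (f i q) = some v
  | .acDown =>
      A.η v = .acDown ∧
      A.lo (f i (q ++ [false])) = some v ∧
      A.lo (f i (q ++ [true])) = some v ∧
      A.up (f (i + 1) q) = some v ∧
      f i (q ++ [false]) ≠ f i (q ++ [true])
  | .acUp =>
      A.η v = .acUp ∧
      A.lo (f i q) = some v ∧
      A.up (f (i + 1) (q ++ [false])) = some v ∧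
      A.up (f (i + 1) (q ++ [true])) = some v ∧
      f (i + 1) (q ++ [false]) ≠ f (i + 1) (q ++ [true])
  | .s => corrCond f i q ψ
      [([false, false], [false]), ([false, true], [true, false]),
       ([true], [true, true])]
  | .m => corrCond f i q ψ
      [([false, false], [false, false]), ([true, false], [false, true]),
       ([false, true], [true, false]), ([true, true], [true, true])]
  | .eqOrComm => corrCond f i q ψ [([false], [true]), ([true], [false])]
  | .eqAndComm => corrCond f i q ψ [([false], [true]), ([true], [false])]
  | .eqOrAssocL => corrCond f i q ψ
      [([false], [false, false]), ([true, false], [false, true]),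
       ([true, true], [true])]
  | .eqOrAssocR => corrCond f i q ψ
      [([false, false], [false]), ([false, true], [true, false]),
       ([true], [true, true])]
  | .eqAndAssocL => corrCond f i q ψ
      [([false], [false, false]), ([true, false], [false, true]),
       ([true, true], [true])]
  | .eqAndAssocR => corrCond f i q ψ
      [([false, false], [false]), ([false, true], [true, false]),
       ([true], [true, true])]
  | .eqOrUnitDel => corrCond f i q ψ [([], [false])]
  | .eqOrUnitAdd => corrCond f i q ψ [([false], [])]
  | .eqAndUnitDel => corrCond f i q ψ [([], [false])]
  | .eqAndUnitAdd => corrCond f i q ψ [([false], [])]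
  | .eqTTDel => True
  | .eqTTAdd => True
  | .eqFFDel => True
  | .eqFFAdd => True

/-- `A` is the atomic flow associated with the derivation `Φ`, where `f`
maps each atom occurrence (formula index, position) of `Φ` to an edge of
`A`, and `g` assigns to each structural inference step its vertex. -/
def IsAssocFlow (Φ : Deriv) (A : PreFlow) (f : ℕ → List Bool → ℕ)
    (g : ℕ → ℕ) : Prop :=
  Φ.WF ∧ A.IsFlow ∧
  (∀ i p, i < Φ.nf → (Φ.fml i).IsOcc p → f i p ∈ A.E) ∧
  (∀ e ∈ A.E, ∃ i p, i < Φ.nf ∧ (Φ.fml i).IsOcc p ∧ f i p = e) ∧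
  (∀ i p p', i < Φ.nf → (Φ.fml i).IsOcc p → (Φ.fml i).IsOcc p' →
    f i p = f i p' → p = p') ∧
  (∀ p, (Φ.fml 0).IsOcc p → A.up (f 0 p) = none) ∧
  (∀ p, (Φ.fml Φ.steps.length).IsOcc p → A.lo (f Φ.steps.length p) = none) ∧
  (∀ i, i < Φ.steps.length → (Φ.stepAt i).1.isStructural = true → g i ∈ A.V) ∧
  (∀ v ∈ A.V, ∃ i, i < Φ.steps.length ∧
    (Φ.stepAt i).1.isStructural = true ∧ g i = v) ∧
  (∀ i j, i < Φ.steps.length → j < Φ.steps.length →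
    (Φ.stepAt i).1.isStructural = true → (Φ.stepAt j).1.isStructural = true →
    g i = g j → i = j) ∧
  (∀ i, i < Φ.steps.length →
    stepCond A f (g i) i (Φ.stepAt i).1 (Φ.stepAt i).2.1
      (Φ.fml i) (Φ.fml (i + 1)))

/-! ### Streamlining. -/

/-- No path from an interaction or weakening vertex to a cointeraction or
coweakening vertex. -/
def NoIWPath (A : PreFlow) : Prop :=
  ¬ ∃ v v' l, v ∈ A.V ∧ v' ∈ A.V ∧
      (A.η v = .aiDown ∨ A.η v = .awDown) ∧
      (A.η v' = .aiUp ∨ A.η v' = .awUp) ∧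
      IsPath A (.ver v) (.ver v') l

/-- `Φ` is a streamlined derivation. -/
def Streamlined (Φ : Deriv) : Prop :=
  ∃ A f g, IsAssocFlow Φ A f g ∧ NoIWPath A

/-- `Φ` is a super-streamlined derivation. -/
def SuperStreamlined (Φ : Deriv) : Prop :=
  ∃ A f g, IsAssocFlow Φ A f g ∧ NoIWPath A ∧ NormalW A

/-- `Φ` is a hyper-streamlined derivation. -/
def HyperStreamlined (Φ : Deriv) : Prop :=
  ∃ A f g, IsAssocFlow Φ A f g ∧ NoIWPath A ∧ NormalW A ∧ NormalC A

end AF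


namespace AF

namespace Formula

/-- Forget the edge names of a labelled formula, in which the atom `(e, _)`
stands for an occurrence traced to the edge `e`, and keep only polarities. -/
def erase (π : ℕ → Bool) : Formula → Formula
  | tt => tt
  | ff => ff
  | atom e _ => atom 0 (π e)
  | or α β => or (erase π α) (erase π β)
  | and α β => and (erase π α) (erase π β)

/-- The edge at a position of a labelled formula. -/
def label (X : Formula) (p : List Bool) : ℕ :=
  match X.sub p with
  | some (atom e _) => e
  | _ => 0

/-- The edges occurring in a labelled formula. -/
def labels : Formula → Multiset ℕ
  | tt => 0
  | ff => 0
  | atom e _ => {e}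
  | or α β => labels α + labels β
  | and α β => labels α + labels β

@[simp] theorem sub_nil (φ : Formula) : φ.sub [] = some φ := by cases φ <;> rfl

@[simp] theorem repl_nil (φ ψ : Formula) : φ.repl [] ψ = ψ := by cases φ <;> rfl

theorem label_mem_labels {π : ℕ → Bool} {X : Formula} {p : List Bool}
    (h : (X.erase π).IsOcc p) : X.label p ∈ X.labels := by
  induction X generalizing p with
  | tt => rcases p with _ | ⟨b, p⟩ <;> simp [IsOcc, erase, sub] at h
  | ff => rcases p with _ | ⟨b, p⟩ <;> simp [IsOcc, erase, sub] at h
  | atom n b =>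
    rcases p with _ | ⟨b, p⟩
    · simp [label, labels]
    · simp [IsOcc, erase, sub] at h
  | or α β ihα ihβ =>
    rcases p with _ | ⟨_ | _, p⟩
    · simp [IsOcc, erase] at h
    · exact Multiset.mem_add.2 (.inl (ihα (p := p) h))
    · exact Multiset.mem_add.2 (.inr (ihβ (p := p) h))
  | and α β ihα ihβ =>
    rcases p with _ | ⟨_ | _, p⟩
    · simp [IsOcc, erase] at h
    · exact Multiset.mem_add.2 (.inl (ihα (p := p) h))
    · exact Multiset.mem_add.2 (.inr (ihβ (p := p) h))

theorem exists_label_eq (π : ℕ → Bool) {X : Formula} {e : ℕ} (h : e ∈ X.labels) :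
    ∃ p, (X.erase π).IsOcc p ∧ X.label p = e := by
  induction X with
  | tt => simp [labels] at h
  | ff => simp [labels] at h
  | atom n b =>
    refine ⟨[], ⟨0, π n, rfl⟩, ?_⟩
    simpa [labels, label, eq_comm] using h
  | or α β ihα ihβ =>
    rcases Multiset.mem_add.1 h with h | h
    · obtain ⟨p, hp⟩ := ihα h
      exact ⟨false :: p, hp⟩
    · obtain ⟨p, hp⟩ := ihβ h
      exact ⟨true :: p, hp⟩
  | and α β ihα ihβ =>
    rcases Multiset.mem_add.1 h with h | h
    · obtain ⟨p, hp⟩ := ihα h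
      exact ⟨false :: p, hp⟩
    · obtain ⟨p, hp⟩ := ihβ h
      exact ⟨true :: p, hp⟩

theorem label_injOn {π : ℕ → Bool} {X : Formula} (hX : X.labels.Nodup) {p p' : List Bool}
    (hp : (X.erase π).IsOcc p) (hp' : (X.erase π).IsOcc p') (h : X.label p = X.label p') :
    p = p' := by
  induction X generalizing p p' with
  | tt => rcases p with _ | ⟨b, p⟩ <;> simp [IsOcc, erase, sub] at hp
  | ff => rcases p with _ | ⟨b, p⟩ <;> simp [IsOcc, erase, sub] at hp
  | atom n b =>
    rcases p with _ | ⟨b, p⟩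
    · rcases p' with _ | ⟨b', p'⟩
      · rfl
      · simp [IsOcc, erase, sub] at hp'
    · simp [IsOcc, erase, sub] at hp
  | or α β ihα ihβ | and α β ihα ihβ =>
    obtain ⟨hα, hβ, hd⟩ := Multiset.nodup_add.1 hX
    have hne : ∀ {q q' : List Bool}, (α.erase π).IsOcc q → (β.erase π).IsOcc q' →
        α.label q ≠ β.label q' := fun hq hq' he =>
      Multiset.disjoint_left.1 hd (label_mem_labels hq) (he ▸ label_mem_labels hq')
    rcases p with _ | ⟨_ | _, p⟩
    · simp [IsOcc, erase] at hp
    all_goals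
      rcases p' with _ | ⟨_ | _, p'⟩
      · simp [IsOcc, erase] at hp'
    · exact congrArg _ (ihα hα (p := p) (p' := p') hp hp' h)
    · exact absurd h (hne (q := p) (q' := p') hp hp')
    · exact absurd h.symm (hne (q := p') (q' := p) hp' hp)
    · exact congrArg _ (ihβ hβ (p := p) (p' := p') hp hp' h)

end Formula

open Formula

theorem RuleInstance.erase (π : ℕ → Bool) {r : RuleName} {X Y : Formula}
    (h : RuleInstance r X Y) (hr : r.isStructural = false) :
    RuleInstance r (X.erase π) (Y.erase π) := by
  cases h <;> first | (simp [RuleName.isStructural] at hr; done) | constructor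

theorem RuleInstance.labels_eq {r : RuleName} {X Y : Formula}
    (h : RuleInstance r X Y) (hr : r.isStructural = false) : X.labels = Y.labels := by
  cases h <;> first
    | (simp [RuleName.isStructural] at hr; done)
    | (simp only [labels, add_zero]; done)
    | (simp only [labels]; abel)

theorem RuleInstance.stepAt {r : RuleName} {φ ψ : Formula} (h : RuleInstance r φ ψ) :
    StepAt r [] φ ψ :=
  ⟨φ, ψ, by simp, h, by simp⟩

/-- The tracing function of a two-formula derivation. -/
def pairTrace (h h' : List Bool → ℕ) : ℕ → List Bool → ℕ
  | 0 => h
  | _ + 1 => h'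

theorem stepCond_congr {A : PreFlow} {f f' : ℕ → List Bool → ℕ} {v i i' : ℕ} {r : RuleName}
    {q : List Bool} {φ ψ : Formula} (h₀ : f i = f' i') (h₁ : f (i + 1) = f' (i' + 1))
    (h : stepCond A f v i r q φ ψ) : stepCond A f' v i' r q φ ψ := by
  simp only [stepCond, corrCond, h₀, h₁] at h ⊢
  exact h

theorem stepCond_cons {A : PreFlow} {f f' : ℕ → List Bool → ℕ} {v i : ℕ} {r : RuleName}
    {q : List Bool} {φ ψ φ' ψ' : Formula} (b : Bool)
    (hφ : ∀ p, φ'.sub (b :: p) = φ.sub p) (hψ : ∀ p, ψ'.sub (b :: p) = ψ.sub p)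
    (h₀ : ∀ p, f' i (b :: p) = f i p) (h₁ : ∀ p, f' (i + 1) (b :: p) = f (i + 1) p)
    (hnil : ¬ φ'.IsOcc []) (hctx : ∀ p, f' (i + 1) ((!b) :: p) = f' i ((!b) :: p))
    (h : stepCond A f v i r q φ ψ) : stepCond A f' v i r (b :: q) φ' ψ' := by
  refine ⟨?_, ?_⟩
  · rintro (_ | ⟨c, p⟩) hp hocc
    · exact absurd hocc hnil
    · rcases eq_or_ne c b with rfl | hc
      · rw [h₀, h₁]
        refine h.1 p (fun hq => hp (by simpa using hq)) ?_
        simpa only [IsOcc, hφ] using hocc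
      · rw [← Bool.not_eq.2 hc.symm] at *
        exact hctx p
  · have h' := h.2
    cases r <;> simp only [corrCond, List.cons_append, h₀, h₁, IsOcc, hψ] at h' ⊢ <;> exact h'

/-- A deep inference step between labelled formulae, traced at the vertex `v`. -/
def TracedStep (A : PreFlow) (π : ℕ → Bool) (v : ℕ) (r : RuleName) (q : List Bool)
    (X Y : Formula) : Prop :=
  StepAt r q (X.erase π) (Y.erase π) ∧
    stepCond A (pairTrace X.label Y.label) v 0 r q (X.erase π) (Y.erase π)

namespace TracedStep

variable {A : PreFlow} {π : ℕ → Bool} {v : ℕ} {r : RuleName} {q : List Bool} {X Y : Formula}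

theorem or_left (Z : Formula) (h : TracedStep A π v r q X Y) :
    TracedStep A π v r (false :: q) (or X Z) (or Y Z) := by
  obtain ⟨⟨γ, δ, h₁, h₂, h₃⟩, h⟩ := h
  refine ⟨⟨γ, δ, h₁, h₂, by simp only [erase, repl, h₃]⟩, ?_⟩
  exact stepCond_cons false (fun _ => rfl) (fun _ => rfl) (fun _ => rfl) (fun _ => rfl)
    (by simp [IsOcc, erase]) (fun _ => rfl) h

theorem or_right (Z : Formula) (h : TracedStep A π v r q X Y) :
    TracedStep A π v r (true :: q) (or Z X) (or Z Y) := by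
  obtain ⟨⟨γ, δ, h₁, h₂, h₃⟩, h⟩ := h
  refine ⟨⟨γ, δ, h₁, h₂, by simp only [erase, repl, h₃]⟩, ?_⟩
  exact stepCond_cons true (fun _ => rfl) (fun _ => rfl) (fun _ => rfl) (fun _ => rfl)
    (by simp [IsOcc, erase]) (fun _ => rfl) h

theorem and_right (Z : Formula) (h : TracedStep A π v r q X Y) :
    TracedStep A π v r (true :: q) (and Z X) (and Z Y) := by
  obtain ⟨⟨γ, δ, h₁, h₂, h₃⟩, h⟩ := h
  refine ⟨⟨γ, δ, h₁, h₂, by simp only [erase, repl, h₃]⟩, ?_⟩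
  exact stepCond_cons true (fun _ => rfl) (fun _ => rfl) (fun _ => rfl) (fun _ => rfl)
    (by simp [IsOcc, erase]) (fun _ => rfl) h

theorem of_ruleInstance (h : RuleInstance r X Y) (hr : r.isStructural = false) :
    TracedStep A π v r [] X Y := by
  refine ⟨(h.erase π hr).stepAt, fun p hp => absurd List.nil_prefix hp, ?_⟩
  cases h <;> first
    | (simp [RuleName.isStructural] at hr; done)
    | trivial
    | simp [corrCond, pairTrace, label, sub]

end TracedStep

/-- A step by a logical rule or by `=` between labelled formulae. -/
def LinearStep (A : PreFlow) (π : ℕ → Bool) (X Y : Formula) : Prop :=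
  X.labels = Y.labels ∧
    ∃ r q, r.isStructural = false ∧ ∀ v, TracedStep A π v r q X Y

/-- Derivability by logical rules and `=` between labelled formulae. -/
abbrev Linear (A : PreFlow) (π : ℕ → Bool) : Formula → Formula → Prop :=
  Relation.ReflTransGen (LinearStep A π)

namespace Linear

variable {A : PreFlow} {π : ℕ → Bool}

theorem labels_eq {X Y : Formula} (h : Linear A π X Y) : X.labels = Y.labels := by
  induction h with
  | refl => rfl
  | tail _ h ih => exact ih.trans h.1

theorem of_rule {r : RuleName} {X Y : Formula} (h : RuleInstance r X Y)
    (hr : r.isStructural = false := by rfl) : Linear A π X Y :=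
  .single ⟨h.labels_eq hr, r, [], hr, fun _ => .of_ruleInstance h hr⟩

theorem or_left {X Y : Formula} (Z : Formula) (h : Linear A π X Y) :
    Linear A π (or X Z) (or Y Z) :=
  h.lift (fun X => or X Z) fun _ _ ⟨hl, r, q, hr, hs⟩ =>
    ⟨by simp only [labels, hl], r, false :: q, hr, fun v => (hs v).or_left Z⟩

theorem or_right {X Y : Formula} (Z : Formula) (h : Linear A π X Y) :
    Linear A π (or Z X) (or Z Y) :=
  h.lift (fun X => or Z X) fun _ _ ⟨hl, r, q, hr, hs⟩ =>
    ⟨by simp only [labels, hl], r, true :: q, hr, fun v => (hs v).or_right Z⟩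

theorem and_right {X Y : Formula} (Z : Formula) (h : Linear A π X Y) :
    Linear A π (and Z X) (and Z Y) :=
  h.lift (fun X => and Z X) fun _ _ ⟨hl, r, q, hr, hs⟩ =>
    ⟨by simp only [labels, hl], r, true :: q, hr, fun v => (hs v).and_right Z⟩

theorem or_comm (X Y : Formula) : Linear A π (or X Y) (or Y X) := of_rule (.eqOrComm X Y)

theorem and_comm (X Y : Formula) : Linear A π (and X Y) (and Y X) := of_rule (.eqAndComm X Y)

theorem or_assoc (X Y Z : Formula) : Linear A π (or (or X Y) Z) (or X (or Y Z)) :=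
  of_rule (.eqOrAssocL X Y Z)

theorem or_assoc' (X Y Z : Formula) : Linear A π (or X (or Y Z)) (or (or X Y) Z) :=
  of_rule (.eqOrAssocR X Y Z)

theorem or_left_comm (X Y Z : Formula) : Linear A π (or X (or Y Z)) (or Y (or X Z)) :=
  ((or_assoc' X Y Z).trans ((or_comm X Y).or_left Z)).trans (or_assoc Y X Z)

theorem ff_tt : Linear A π ff tt :=
  (of_rule (.eqAndUnitAdd ff)).trans <|
  ((of_rule .eqTTAdd).and_right ff).trans <|
  (of_rule (.s ff tt tt)).trans <|
  ((of_rule (.eqAndUnitDel ff)).or_left tt).trans <|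
  (or_comm ff tt).trans <| of_rule (.eqOrUnitDel tt)

/-- The mix rule. -/
theorem and_or (X Y : Formula) : Linear A π (and X Y) (or X Y) :=
  ((of_rule (.eqOrUnitAdd Y)).and_right X).trans <|
  ((or_comm Y ff).and_right X).trans <|
  (of_rule (.s X ff Y)).trans <|
  ((ff_tt.and_right X).or_left Y).trans <|
  (of_rule (.eqAndUnitDel X)).or_left Y

theorem or_and (X Y : Formula) : Linear A π (or X Y) (or (and X Y) tt) :=
  ((of_rule (.eqAndUnitAdd X)).or_left Y).trans <|
  ((of_rule (.eqAndUnitAdd Y)).or_right _).trans <|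
  ((and_comm Y tt).or_right _).trans <|
  (of_rule (.m X tt tt Y)).trans <|
  ((or_comm tt Y).and_right _).trans <|
  (of_rule (.s (or X tt) Y tt)).trans <|
  ((and_comm (or X tt) Y).or_left tt).trans <|
  ((of_rule (.s Y X tt)).or_left tt).trans <|
  (or_assoc (and Y X) tt tt).trans <|
  ((of_rule .eqTTDel).or_right _).trans <|
  (and_comm Y X).or_left tt

end Linear

/-- The disjunction of the edges of a list, with a spare unit `t`. -/
def cutFormula : List ℕ → Formula
  | [] => tt
  | e :: l => or (atom e true) (cutFormula l)

theorem labels_cutFormula (l : List ℕ) : (cutFormula l).labels = l := by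
  induction l with
  | nil => rfl
  | cons e l ih => simp [cutFormula, labels, ih]

namespace Linear

variable {A : PreFlow} {π : ℕ → Bool}

theorem cutFormula_perm {l l' : List ℕ} (h : l.Perm l') :
    Linear A π (cutFormula l) (cutFormula l') := by
  induction h with
  | nil => exact .refl
  | cons e _ ih => exact ih.or_right _
  | swap a b l => exact or_left_comm _ _ _
  | trans _ _ ih₁ ih₂ => exact ih₁.trans ih₂

theorem tt_or_cutFormula (l : List ℕ) :
    Linear A π (or tt (cutFormula l)) (cutFormula l) := by
  induction l with
  | nil => exact of_rule .eqTTDel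
  | cons e l ih => exact (or_left_comm _ _ _).trans (ih.or_right _)

theorem cutFormula_tt_or (l : List ℕ) :
    Linear A π (cutFormula l) (or tt (cutFormula l)) := by
  induction l with
  | nil => exact of_rule .eqTTAdd
  | cons e l ih => exact (ih.or_right _).trans (or_left_comm _ _ _)

end Linear

/-- The labelled formula `X` mentions edges of `A` only, each at most once. -/
def EdgesOK (A : PreFlow) (X : Formula) : Prop :=
  X.labels.Nodup ∧ ∀ e ∈ X.labels, e ∈ A.E

/-- Traced derivability: `vs` lists the vertices of the structural steps, and the
edges in `es` all occur along the derivation. -/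
inductive Reach (A : PreFlow) (π : ℕ → Bool) : Formula → List ℕ → Set ℕ → Formula → Prop
  | refl {X : Formula} : EdgesOK A X → Reach A π X [] {e | e ∈ X.labels} X
  | linear {X Y Z : Formula} {vs : List ℕ} {es : Set ℕ} : EdgesOK A X → LinearStep A π X Y →
      Reach A π Y vs es Z → Reach A π X vs es Z
  | structural {X Y Z : Formula} {v : ℕ} {vs : List ℕ} {es : Set ℕ} {r : RuleName}
      {q : List Bool} : EdgesOK A X → r.isStructural = true → TracedStep A π v r q X Y →
      Reach A π Y vs es Z → Reach A π X (v :: vs) (es ∪ {e | e ∈ X.labels}) Z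

namespace Reach

variable {A : PreFlow} {π : ℕ → Bool}

theorem edgesOK {X Z : Formula} {vs : List ℕ} {es : Set ℕ} (h : Reach A π X vs es Z) :
    EdgesOK A X := by
  cases h <;> assumption

theorem of_linear {X Y Z : Formula} {vs : List ℕ} {es : Set ℕ} (h : Linear A π X Y)
    (hY : Reach A π Y vs es Z) : Reach A π X vs es Z := by
  induction h using Relation.ReflTransGen.head_induction_on with
  | refl => exact hY
  | head h _ ih => exact .linear (by simpa only [EdgesOK, h.1] using ih.edgesOK) h ih

theorem of_structural {X X' Y' Y Z : Formula} {v : ℕ} {vs : List ℕ} {es : Set ℕ} {r : RuleName}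
    {q : List Bool} (hX : EdgesOK A X) (h : Linear A π X X') (hr : r.isStructural = true)
    (hs : TracedStep A π v r q X' Y') (h' : Linear A π Y' Y) (hY : Reach A π Y vs es Z) :
    Reach A π X (v :: vs) (es ∪ {e | e ∈ X.labels}) Z := by
  refine of_linear h ?_
  rw [h.labels_eq]
  exact .structural (by simpa only [EdgesOK, h.labels_eq] using hX) hr hs (of_linear h' hY)

end Reach

/-- The derivation `Φ` from `X` to `Z`, traced by `f` and `g`, witnesses `Reach`. -/
structure Realizes (A : PreFlow) (π : ℕ → Bool) (X : Formula) (vs : List ℕ) (es : Set ℕ)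
    (Z : Formula) (Φ : Deriv) (f : ℕ → List Bool → ℕ) (g : ℕ → ℕ) : Prop where
  prem : Φ.prem = X.erase π
  prem_label : f 0 = X.label
  concl : Φ.concl = Z.erase π
  concl_label : f Φ.steps.length = Z.label
  wf : Φ.WF
  edge_mem : ∀ i p, i < Φ.nf → (Φ.fml i).IsOcc p → f i p ∈ A.E
  edge_surj : ∀ e ∈ es, ∃ i p, i < Φ.nf ∧ (Φ.fml i).IsOcc p ∧ f i p = e
  edge_inj : ∀ i p p', i < Φ.nf → (Φ.fml i).IsOcc p → (Φ.fml i).IsOcc p' →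
    f i p = f i p' → p = p'
  vertex_mem : ∀ i, i < Φ.steps.length → (Φ.stepAt i).1.isStructural = true → g i ∈ vs
  vertex_surj : ∀ v ∈ vs, ∃ i, i < Φ.steps.length ∧
    (Φ.stepAt i).1.isStructural = true ∧ g i = v
  vertex_inj : vs.Nodup → ∀ i j, i < Φ.steps.length → j < Φ.steps.length →
    (Φ.stepAt i).1.isStructural = true → (Φ.stepAt j).1.isStructural = true →
    g i = g j → i = j
  step : ∀ i, i < Φ.steps.length →
    stepCond A f (g i) i (Φ.stepAt i).1 (Φ.stepAt i).2.1 (Φ.fml i) (Φ.fml (i + 1))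

/-- Prepend a step to a derivation. -/
def Deriv.cons (φ : Formula) (r : RuleName) (q : List Bool) (Φ : Deriv) : Deriv :=
  ⟨φ, (r, q, Φ.prem) :: Φ.steps⟩

theorem Deriv.fml_cons_succ (φ : Formula) (r : RuleName) (q : List Bool) (Φ : Deriv) {i : ℕ}
    (hi : i < Φ.nf) : (Φ.cons φ r q).fml (i + 1) = Φ.fml i := by
  have hi' : i < (Φ.prem :: Φ.steps.map (fun t => t.2.2)).length := by simpa [nf] using hi
  simp only [fml, cons, List.map_cons, List.getD_cons_succ]
  rw [List.getD_eq_getElem _ _ hi', List.getD_eq_getElem _ _ hi']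

theorem Deriv.fml_zero (Φ : Deriv) : Φ.fml 0 = Φ.prem := rfl

/-- Prepend a value to a sequence. -/
def seqCons {α : Type*} (a : α) (s : ℕ → α) : ℕ → α
  | 0 => a
  | i + 1 => s i

theorem Realizes.cons {A : PreFlow} {π : ℕ → Bool} {X Y Z : Formula} {vs vs' : List ℕ}
    {es es' : Set ℕ} {Φ : Deriv} {f : ℕ → List Bool → ℕ} {g : ℕ → ℕ} {v : ℕ} {r : RuleName}
    {q : List Bool} (h : Realizes A π Y vs es Z Φ f g) (hX : EdgesOK A X)
    (hs : TracedStep A π v r q X Y) (hes : es' ⊆ es ∪ {e | e ∈ X.labels})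
    (hvs : vs' = if r.isStructural = true then v :: vs else vs) :
    Realizes A π X vs' es' Z (Φ.cons (X.erase π) r q) (seqCons X.label f) (seqCons v g) where
  prem := rfl
  prem_label := rfl
  concl := by
    rw [← h.concl]
    exact Deriv.fml_cons_succ _ _ _ _ (Nat.lt_succ_self _)
  concl_label := h.concl_label
  wf := by
    rintro (_ | i) hi
    · rw [Deriv.fml_cons_succ _ _ _ _ (Nat.succ_pos _), Deriv.fml_zero, Deriv.fml_zero, h.prem]
      exact hs.1
    · have hi : i < Φ.steps.length := Nat.lt_of_succ_lt_succ hi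
      rw [Deriv.fml_cons_succ _ _ _ _ (by simp only [Deriv.nf]; omega),
        Deriv.fml_cons_succ _ _ _ _ (by simp only [Deriv.nf]; omega)]
      exact h.wf i hi
  edge_mem := by
    rintro (_ | i) p hi hp
    · exact hX.2 _ (label_mem_labels hp)
    · have hi : i < Φ.nf := Nat.lt_of_succ_lt_succ hi
      rw [Deriv.fml_cons_succ _ _ _ _ hi] at hp
      exact h.edge_mem i p hi hp
  edge_surj := by
    intro e he
    rcases hes he with he | he
    · obtain ⟨i, p, hi, hp, hf⟩ := h.edge_surj e he
      exact ⟨i + 1, p, Nat.succ_lt_succ hi, by rwa [Deriv.fml_cons_succ _ _ _ _ hi], hf⟩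
    · obtain ⟨p, hp, hl⟩ := exists_label_eq π he
      exact ⟨0, p, Nat.succ_pos _, hp, hl⟩
  edge_inj := by
    rintro (_ | i) p p' hi hp hp' hf
    · exact label_injOn hX.1 hp hp' hf
    · have hi : i < Φ.nf := Nat.lt_of_succ_lt_succ hi
      rw [Deriv.fml_cons_succ _ _ _ _ hi] at hp hp'
      exact h.edge_inj i p p' hi hp hp' hf
  vertex_mem := by
    rintro (_ | i) hi hr
    · rw [hvs, if_pos (show r.isStructural = true from hr)]
      exact List.mem_cons_self
    · have := h.vertex_mem i (Nat.lt_of_succ_lt_succ hi) hr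
      rw [hvs]
      split
      · exact List.mem_cons_of_mem _ this
      · exact this
  vertex_surj := by
    have key : ∀ w ∈ vs, ∃ i, i < (Φ.cons (X.erase π) r q).steps.length ∧
        ((Φ.cons (X.erase π) r q).stepAt i).1.isStructural = true ∧ seqCons v g i = w := by
      intro w hw
      obtain ⟨i, hi, hr, hg⟩ := h.vertex_surj w hw
      exact ⟨i + 1, Nat.succ_lt_succ hi, hr, hg⟩
    intro w hw
    rw [hvs] at hw
    split at hw
    · rcases List.mem_cons.1 hw with rfl | hw
      · exact ⟨0, Nat.succ_pos _, ‹_›, rfl⟩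
      · exact key w hw
    · exact key w hw
  vertex_inj := by
    intro hnd
    have hv : r.isStructural = true → v ∉ vs := by
      intro hr
      rw [hvs, if_pos hr] at hnd
      exact (List.nodup_cons.1 hnd).1
    have hnd' : vs.Nodup := by
      rw [hvs] at hnd
      split at hnd
      · exact (List.nodup_cons.1 hnd).2
      · exact hnd
    rintro (_ | i) (_ | j) hi hj hri hrj hg
    · rfl
    · refine absurd (h.vertex_mem j (Nat.lt_of_succ_lt_succ hj) hrj) ?_
      rw [← show v = g j from hg]
      exact hv hri
    · refine absurd (h.vertex_mem i (Nat.lt_of_succ_lt_succ hi) hri) ?_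
      rw [show g i = v from hg]
      exact hv hrj
    · exact congrArg _ (h.vertex_inj hnd' i j (Nat.lt_of_succ_lt_succ hi)
        (Nat.lt_of_succ_lt_succ hj) hri hrj hg)
  step := by
    rintro (_ | i) hi
    · rw [Deriv.fml_cons_succ _ _ _ _ (Nat.succ_pos _), Deriv.fml_zero, Deriv.fml_zero, h.prem]
      exact stepCond_congr (f := pairTrace X.label Y.label) (i := 0) rfl h.prem_label.symm hs.2
    · have hi : i < Φ.steps.length := Nat.lt_of_succ_lt_succ hi
      rw [Deriv.fml_cons_succ _ _ _ _ (by simp only [Deriv.nf]; omega),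
        Deriv.fml_cons_succ _ _ _ _ (by simp only [Deriv.nf]; omega)]
      exact stepCond_congr (f := f) (i := i) rfl rfl (h.step i hi)

theorem Reach.exists_realizes {A : PreFlow} {π : ℕ → Bool} {X Z : Formula} {vs : List ℕ}
    {es : Set ℕ} (h : Reach A π X vs es Z) : ∃ Φ f g, Realizes A π X vs es Z Φ f g := by
  induction h with
  | @refl X hX =>
    refine ⟨⟨X.erase π, []⟩, fun _ => X.label, fun _ => 0, ?_⟩
    have hf : ∀ i, i < (⟨X.erase π, []⟩ : Deriv).nf →
        (⟨X.erase π, []⟩ : Deriv).fml i = X.erase π := by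
      intro i hi
      obtain rfl : i = 0 := by simpa [Deriv.nf] using hi
      rfl
    exact
      { prem := rfl
        prem_label := rfl
        concl := rfl
        concl_label := rfl
        wf := fun i hi => absurd hi (Nat.not_lt_zero i)
        edge_mem := fun i p hi hp => hX.2 _ (label_mem_labels (hf i hi ▸ hp))
        edge_surj := fun e he => by
          obtain ⟨p, hp, hl⟩ := exists_label_eq π he
          exact ⟨0, p, Nat.succ_pos _, hp, hl⟩
        edge_inj := fun i p p' hi hp hp' =>
          label_injOn hX.1 (hf i hi ▸ hp) (hf i hi ▸ hp')
        vertex_mem := fun i hi => absurd hi (Nat.not_lt_zero i)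
        vertex_surj := fun v hv => absurd hv List.not_mem_nil
        vertex_inj := fun _ i _ hi => absurd hi (Nat.not_lt_zero i)
        step := fun i hi => absurd hi (Nat.not_lt_zero i) }
  | linear hX hs _ ih =>
    obtain ⟨Φ, f, g, h⟩ := ih
    obtain ⟨_, r, q, hr, hs⟩ := hs
    exact ⟨_, _, _, h.cons hX (hs 0) Set.subset_union_left (by simp [hr])⟩
  | structural hX hr hs _ ih =>
    obtain ⟨Φ, f, g, h⟩ := ih
    exact ⟨_, _, _, h.cons hX hs subset_rfl (by simp [hr])⟩


namespace TracedStep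

variable {A : PreFlow} {π : ℕ → Bool} {v a b c : ℕ}

theorem aiDown (hv : A.η v = .aiDown) (ha : A.up a = some v) (hb : A.up b = some v)
    (hab : a ≠ b) (hπ : π b = !π a) :
    TracedStep A π v .aiDown [] tt (or (atom a true) (atom b true)) := by
  refine ⟨?_, fun p hp => absurd List.nil_prefix hp, hv, ha, hb, hab⟩
  simp only [erase, hπ]
  exact (RuleInstance.aiDown 0 (π a)).stepAt

theorem aiUp (hv : A.η v = .aiUp) (ha : A.lo a = some v) (hb : A.lo b = some v)
    (hab : a ≠ b) (hπ : π b = !π a) :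
    TracedStep A π v .aiUp [] (and (atom a true) (atom b true)) ff := by
  refine ⟨?_, fun p hp => absurd List.nil_prefix hp, hv, ha, hb, hab⟩
  simp only [erase, hπ]
  exact (RuleInstance.aiUp 0 (π a)).stepAt

theorem awDown (hv : A.η v = .awDown) (ha : A.up a = some v) :
    TracedStep A π v .awDown [] ff (atom a true) :=
  ⟨(RuleInstance.awDown 0 (π a)).stepAt, fun p hp => absurd List.nil_prefix hp, hv, ha⟩

theorem awUp (hv : A.η v = .awUp) (ha : A.lo a = some v) :
    TracedStep A π v .awUp [] (atom a true) tt :=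
  ⟨(RuleInstance.awUp 0 (π a)).stepAt, fun p hp => absurd List.nil_prefix hp, hv, ha⟩

theorem acDown (hv : A.η v = .acDown) (ha : A.lo a = some v) (hb : A.lo b = some v)
    (hc : A.up c = some v) (hab : a ≠ b) (hπa : π a = π c) (hπb : π b = π c) :
    TracedStep A π v .acDown [] (or (atom a true) (atom b true)) (atom c true) := by
  refine ⟨?_, fun p hp => absurd List.nil_prefix hp, hv, ha, hb, hc, hab⟩
  simp only [erase, hπa, hπb]
  exact (RuleInstance.acDown 0 (π c)).stepAt

theorem acUp (hv : A.η v = .acUp) (hc : A.lo c = some v) (ha : A.up a = some v)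
    (hb : A.up b = some v) (hab : a ≠ b) (hπa : π a = π c) (hπb : π b = π c) :
    TracedStep A π v .acUp [] (atom c true) (and (atom a true) (atom b true)) := by
  refine ⟨?_, fun p hp => absurd List.nil_prefix hp, hv, hc, ha, hb, hab⟩
  simp only [erase, hπa, hπb]
  exact (RuleInstance.acUp 0 (π c)).stepAt

end TracedStep

theorem exists_toList_eq_of_card_one {s : Finset ℕ} (h : s.card = 1) :
    ∃ a, s.toList = [a] ∧ a ∈ s := by
  obtain ⟨a, ha⟩ := List.length_eq_one_iff.1 (s.length_toList.trans h)
  exact ⟨a, ha, Finset.mem_toList.1 (by simp [ha])⟩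

theorem exists_toList_eq_of_card_two {s : Finset ℕ} (h : s.card = 2) :
    ∃ a b, s.toList = [a, b] ∧ a ∈ s ∧ b ∈ s ∧ a ≠ b ∧ ∀ e ∈ s, e = a ∨ e = b := by
  obtain ⟨a, b, hab⟩ := List.length_eq_two.1 (s.length_toList.trans h)
  refine ⟨a, b, hab, Finset.mem_toList.1 (by simp [hab]), Finset.mem_toList.1 (by simp [hab]),
    ?_, fun e he => ?_⟩
  · have := s.nodup_toList
    simpa [hab] using this
  · simpa [hab] using Finset.mem_toList.2 he

namespace PreFlow

variable {A : PreFlow} {π : ℕ → Bool} {v e : ℕ}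

theorem mem_Ledges : e ∈ A.Ledges v ↔ e ∈ A.E ∧ A.up e = some v := by simp [Ledges]

theorem mem_Uedges : e ∈ A.Uedges v ↔ e ∈ A.E ∧ A.lo e = some v := by simp [Uedges]

theorem PolarityOK.eq_not (hπ : A.PolarityOK π) (hv : v ∈ A.V)
    (hη : A.η v = .aiDown ∨ A.η v = .aiUp) {a b : ℕ} (h : ∀ e ∈ A.edges v, e = a ∨ e = b) :
    π b = !π a := by
  obtain ⟨e₁, h₁, e₂, h₂, hne⟩ := (hπ v hv).2 hη
  rcases h e₁ h₁ with rfl | rfl <;> rcases h e₂ h₂ with rfl | rfl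
  · exact absurd rfl hne
  · exact Bool.eq_not.2 hne.symm
  · exact Bool.eq_not.2 hne
  · exact absurd rfl hne

end PreFlow

open PreFlow

/-- The structural step of a vertex `v` replaces the upper edges of `v` by its lower edges. -/
theorem Reach.of_vertex {A : PreFlow} {π : ℕ → Bool} (hd : A.degOK) (hπ : A.PolarityOK π)
    {v : ℕ} (hv : v ∈ A.V) {l vs : List ℕ} {es : Set ℕ} {Z : Formula}
    (hX : EdgesOK A (cutFormula ((A.Uedges v).toList ++ l)))
    (hY : Reach A π (cutFormula ((A.Ledges v).toList ++ l)) vs es Z) :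
    Reach A π (cutFormula ((A.Uedges v).toList ++ l)) (v :: vs)
      (es ∪ {e | e ∈ (cutFormula ((A.Uedges v).toList ++ l)).labels}) Z := by
  obtain ⟨hL, hU⟩ := hd v hv
  cases hη : A.η v <;> rw [hη] at hL hU <;> simp only [labDeg] at hL hU
  case aiDown =>
    obtain ⟨a, b, hab, ha, hb, hne, hall⟩ := exists_toList_eq_of_card_two hL
    rw [Finset.card_eq_zero] at hU
    have hπab := hπ.eq_not hv (.inl hη) (a := a) (b := b) (by simpa [edges, hU] using hall)
    rw [hab] at hY
    rw [hU, Finset.toList_empty] at hX ⊢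
    exact .of_structural hX (Linear.cutFormula_tt_or l) rfl
      ((TracedStep.aiDown hη (mem_Ledges.1 ha).2 (mem_Ledges.1 hb).2 hne hπab).or_left _)
      (Linear.or_assoc _ _ _) hY
  case aiUp =>
    obtain ⟨a, b, hab, ha, hb, hne, hall⟩ := exists_toList_eq_of_card_two hU
    rw [Finset.card_eq_zero] at hL
    have hπab := hπ.eq_not hv (.inr hη) (a := a) (b := b) (by simpa [edges, hL] using hall)
    rw [hab] at hX ⊢
    rw [hL, Finset.toList_empty] at hY
    refine .of_structural hX
      ((Linear.or_assoc' _ _ _).trans ((Linear.or_and _ _).or_left _)) rfl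
      (((TracedStep.aiUp hη (mem_Uedges.1 ha).2 (mem_Uedges.1 hb).2 hne hπab).or_left
        tt).or_left _) ?_ hY
    exact ((Linear.or_comm ff tt).or_left _).trans <|
      ((Linear.of_rule (.eqOrUnitDel tt)).or_left _).trans (Linear.tt_or_cutFormula l)
  case awDown =>
    obtain ⟨a, hal, ha⟩ := exists_toList_eq_of_card_one hL
    rw [Finset.card_eq_zero] at hU
    rw [hal] at hY
    rw [hU, Finset.toList_empty] at hX ⊢
    exact .of_structural hX
      ((Linear.of_rule (.eqOrUnitAdd (cutFormula l))).trans (Linear.or_comm _ ff)) rfl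
      ((TracedStep.awDown hη (mem_Ledges.1 ha).2).or_left _) .refl hY
  case awUp =>
    obtain ⟨a, hal, ha⟩ := exists_toList_eq_of_card_one hU
    rw [Finset.card_eq_zero] at hL
    rw [hal] at hX ⊢
    rw [hL, Finset.toList_empty] at hY
    exact .of_structural hX .refl rfl ((TracedStep.awUp hη (mem_Uedges.1 ha).2).or_left _)
      (Linear.tt_or_cutFormula l) hY
  case acDown =>
    obtain ⟨a, b, hab, ha, hb, hne, -⟩ := exists_toList_eq_of_card_two hU
    obtain ⟨c, hcl, hc⟩ := exists_toList_eq_of_card_one hL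
    have hpol := (hπ v hv).1 (.inl hη)
    have hc' : c ∈ A.edges v := Finset.mem_union_left _ hc
    rw [hab] at hX ⊢
    rw [hcl] at hY
    exact .of_structural hX (Linear.or_assoc' _ _ _) rfl
      ((TracedStep.acDown hη (mem_Uedges.1 ha).2 (mem_Uedges.1 hb).2 (mem_Ledges.1 hc).2 hne
        (hpol a (Finset.mem_union_right _ ha) c hc')
        (hpol b (Finset.mem_union_right _ hb) c hc')).or_left _) .refl hY
  case acUp =>
    obtain ⟨a, b, hab, ha, hb, hne, -⟩ := exists_toList_eq_of_card_two hL
    obtain ⟨c, hcl, hc⟩ := exists_toList_eq_of_card_one hU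
    have hpol := (hπ v hv).1 (.inr hη)
    have hc' : c ∈ A.edges v := Finset.mem_union_right _ hc
    rw [hcl] at hX ⊢
    rw [hab] at hY
    exact .of_structural hX .refl rfl
      ((TracedStep.acUp hη (mem_Uedges.1 hc).2 (mem_Ledges.1 ha).2 (mem_Ledges.1 hb).2 hne
        (hpol a (Finset.mem_union_left _ ha) c hc')
        (hpol b (Finset.mem_union_left _ hb) c hc')).or_left _)
      (((Linear.and_or _ _).or_left _).trans (Linear.or_assoc _ _ _)) hY

/-- A nonempty set of vertices of an acyclic flow has an uppermost vertex. -/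
theorem PreFlow.Acyclic.exists_uppermost {A : PreFlow} (hA : A.Acyclic) {W : Finset ℕ}
    (hW : W.Nonempty) :
    ∃ v ∈ W, ∀ e ∈ A.E, A.lo e = some v → ∀ w ∈ W, A.up e ≠ some w := by
  by_contra! hcon
  have hcon' : ∀ v : W, ∃ (e : ℕ) (w : W), e ∈ A.E ∧ A.lo e = some v.1 ∧ A.up e = some w.1 := by
    rintro ⟨v, hv⟩
    obtain ⟨e, he, hlo, w, hw, hup⟩ := hcon v hv
    exact ⟨e, ⟨w, hw⟩, he, hlo, hup⟩
  choose N F hE hlo hup using hcon'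
  obtain ⟨v₀, hv₀⟩ := hW
  let x : ℕ → W := fun k => F^[k] ⟨v₀, hv₀⟩
  have hx : ∀ k, x (k + 1) = F (x k) := fun k => Function.iterate_succ_apply' _ _ _
  obtain ⟨i, j, hij, hxij⟩ : ∃ i j, i < j ∧ x i = x j := by
    obtain ⟨i, j, hne, h⟩ := Finite.exists_ne_map_eq_of_infinite x
    rcases lt_or_gt_of_ne hne with hlt | hlt
    · exact ⟨i, j, hlt, h⟩
    · exact ⟨j, i, hlt, h.symm⟩
  obtain ⟨h, rfl⟩ := Nat.exists_eq_add_of_lt hij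
  refine hA ⟨h, fun k => N (x (i + k)), fun k => hE _, fun k => ⟨by simp [hup], ?_⟩⟩
  rw [hup, hlo, ← hx, Fin.val_add_one]
  split
  · next hk =>
    rw [hk, Fin.val_last]
    exact congrArg (fun w : W => some w.1) hxij.symm
  · rfl

theorem exists_reach {A : PreFlow} {π : ℕ → Bool} (hd : A.degOK) (hA : A.Acyclic)
    (hπ : A.PolarityOK π) (n : ℕ) (W : Finset ℕ) (hn : W.card = n) (hW : W ⊆ A.V)
    (hlow : ∀ e ∈ A.E, ∀ w ∈ W, A.up e = some w → ∀ u, A.lo e = some u → u ∈ W)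
    (l : List ℕ) (hl : l.Nodup)
    (hmem : ∀ e, e ∈ l ↔
      e ∈ A.E ∧ (∀ w ∈ W, A.up e ≠ some w) ∧ ∀ u, A.lo e = some u → u ∈ W) :
    ∃ vs es Z, Reach A π (cutFormula l) vs es Z ∧ vs.Nodup ∧ (∀ v, v ∈ vs ↔ v ∈ W) ∧
      (∀ e ∈ A.E, (e ∈ l ∨ ∃ w ∈ W, A.up e = some w) → e ∈ es) ∧
      ∀ e ∈ Z.labels, A.lo e = none := by
  induction n generalizing W l with
  | zero =>
    obtain rfl := Finset.card_eq_zero.1 hn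
    refine ⟨[], _, _, .refl ⟨?_, ?_⟩, List.nodup_nil, by simp, ?_, ?_⟩
    · simpa [labels_cutFormula] using hl
    · simpa [labels_cutFormula] using fun e he => ((hmem e).1 he).1
    · simp [labels_cutFormula]
    · intro e he
      rw [labels_cutFormula, Multiset.mem_coe, hmem] at he
      exact Option.eq_none_iff_forall_ne_some.2 fun u hu => by simpa using he.2.2 u hu
  | succ n ih =>
    obtain ⟨v, hv, hmin⟩ := hA.exists_uppermost (W := W) (Finset.card_pos.1 (by omega))
    set rest := l.filter (· ∉ A.Uedges v) with hrest
    have hmem_rest : ∀ e, e ∈ rest ↔ e ∈ l ∧ ¬ (e ∈ A.E ∧ A.lo e = some v) := fun e => by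
      rw [← mem_Uedges]
      simp [hrest]
    have hU : ∀ e ∈ A.Uedges v, e ∈ l := by
      intro e he
      rw [mem_Uedges] at he
      refine (hmem e).2 ⟨he.1, hmin e he.1 he.2, fun u hu => ?_⟩
      rw [he.2, Option.some.injEq] at hu
      exact hu ▸ hv
    have hnodup : ((A.Uedges v).toList ++ rest).Nodup := by
      refine List.nodup_append'.2 ⟨Finset.nodup_toList _, hl.filter _, fun e he he' => ?_⟩
      rw [Finset.mem_toList, mem_Uedges] at he
      exact ((hmem_rest e).1 he').2 he
    have hperm : l.Perm ((A.Uedges v).toList ++ rest) := by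
      refine (List.perm_ext_iff_of_nodup hl hnodup).2 fun e => ?_
      rw [List.mem_append, Finset.mem_toList, hmem_rest, ← mem_Uedges]
      constructor
      · intro h
        by_cases he : e ∈ A.Uedges v
        · exact .inl he
        · exact .inr ⟨h, he⟩
      · rintro (h | h)
        · exact hU e h
        · exact h.1
    obtain ⟨vs, es, Z, hreach, hvs, hvsW, hes, hZ⟩ := ih (W.erase v)
      (by rw [Finset.card_erase_of_mem hv, hn, Nat.add_sub_cancel])
      ((Finset.erase_subset _ _).trans hW)
      (fun e he w hw hup u hlo => by
        replace hw := Finset.mem_of_mem_erase hw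
        refine Finset.mem_erase.2 ⟨?_, hlow e he w hw hup u hlo⟩
        rintro rfl
        exact hmin e he hlo w hw hup)
      ((A.Ledges v).toList ++ rest)
      (by
        refine List.nodup_append'.2 ⟨Finset.nodup_toList _, hl.filter _, fun e he he' => ?_⟩
        rw [Finset.mem_toList, mem_Ledges] at he
        exact ((hmem e).1 ((hmem_rest e).1 he').1).2.1 v hv he.2)
      (fun e => by
        rw [List.mem_append, Finset.mem_toList, mem_Ledges, hmem_rest, hmem]
        grind)
    refine ⟨v :: vs, _, Z, .of_linear (Linear.cutFormula_perm hperm)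
      (.of_vertex hd hπ (hW hv) ⟨?_, ?_⟩ hreach), ?_, ?_, ?_, hZ⟩
    · simpa only [labels_cutFormula, Multiset.coe_nodup] using hnodup
    · intro e he
      rw [labels_cutFormula, Multiset.mem_coe] at he
      exact ((hmem e).1 (hperm.mem_iff.2 he)).1
    · exact List.nodup_cons.2 ⟨fun h => by simpa using (hvsW v).1 h, hvs⟩
    · intro w
      rw [List.mem_cons, hvsW, Finset.mem_erase]
      grind
    · intro e he h
      rw [labels_cutFormula, Set.mem_union, Set.mem_ofPred_eq, Multiset.mem_coe,
        ← hperm.mem_iff]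
      rcases h with h | ⟨w, hw, hup⟩
      · exact .inr h
      · refine .inl (hes e he ?_)
        rcases eq_or_ne w v with rfl | hwv
        · exact .inl (List.mem_append_left _ (Finset.mem_toList.2 (mem_Ledges.2 ⟨he, hup⟩)))
        · exact .inr ⟨w, Finset.mem_erase.2 ⟨hwv, hw⟩, hup⟩

/-- Every atomic flow is the atomic flow associated with
some SKS derivation. -/
theorem statement_4 (A : PreFlow) (hA : A.IsFlow) :
    ∃ (Φ : Deriv) (f : ℕ → List Bool → ℕ) (g : ℕ → ℕ),
      IsAssocFlow Φ A f g := by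
  obtain ⟨hd, hend, hac, π, hπ⟩ := id hA
  have hmem : ∀ e, e ∈ (A.E.filter fun e => A.up e = none).toList ↔
      e ∈ A.E ∧ A.up e = none := by simp
  obtain ⟨vs, es, Z, hreach, hvs, hvsV, hes, hZ⟩ := exists_reach hd hac hπ _ A.V rfl subset_rfl
    (fun e he _ _ _ u hu => (hend e he).2 u hu) (A.E.filter fun e => A.up e = none).toList
    (Finset.nodup_toList _) (fun e => by
      rw [hmem]
      constructor
      · rintro ⟨he, hup⟩
        exact ⟨he, by simp [hup], (hend e he).2⟩
      · rintro ⟨he, hup, -⟩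
        exact ⟨he, Option.eq_none_iff_forall_ne_some.2 fun w hw =>
          hup w ((hend e he).1 w hw) hw⟩)
  obtain ⟨Φ, f, g, h⟩ := hreach.exists_realizes
  refine ⟨Φ, f, g, h.wf, hA, h.edge_mem, fun e he => h.edge_surj e (hes e he ?_), h.edge_inj,
    fun p hp => ?_, fun p hp => ?_, fun i hi hr => (hvsV _).1 (h.vertex_mem i hi hr),
    fun v hv => h.vertex_surj v ((hvsV v).2 hv), h.vertex_inj hvs, h.step⟩
  · rw [hmem]
    rcases hup : A.up e with _ | w
    · exact .inl ⟨he, rfl⟩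
    · exact .inr ⟨w, (hend e he).1 w hup, rfl⟩
  · rw [Deriv.fml_zero, h.prem] at hp
    have := label_mem_labels hp
    rw [labels_cutFormula, Multiset.mem_coe, hmem] at this
    rw [h.prem_label]
    exact this.2
  · have hc : Φ.fml Φ.steps.length = Z.erase π := h.concl
    rw [hc] at hp
    rw [h.concl_label]
    exact hZ _ (label_mem_labels hp)

end AF
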